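/- arXiv:q-alg/9612016 — 3 statements merged into one kernel-verified Lean document; each statement's English description precedes it below -/
import Mathlib

section
/- Let $A$ be a unital associative algebra over a field $F$ and let $q \in F^\times$ not be a root of unity. Suppose $X, Z, K \in A$ satisfy $XK = KX$, $KZ = q^{-1} Z K$, $ZX = q\,XZ$, and $X$ and $Z$ are nilpotent. Then $XK + Z$ is nilpotent, and for any left $A$-module $M$ and any $v \in M$ with $Kv = v$ one has $\exp_q(XK + Z)\, v = \exp_q(X)\,\exp_q(Z)\, v$. -/
open scoped BigOperators

/-- The symmetric q-integer `[k]_q = (q^k - q^{-k})/(q - q^{-1}) = q^{k-1} + q^{k-3} + ⋯ + q^{1-k}`. -/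
def qint {F : Type*} [Field F] (q : F) (k : ℕ) : F :=
  ∑ i ∈ Finset.range k, q ^ (k - 1 - i) * q⁻¹ ^ i

/-- The q-factorial `[k]_q! = [1]_q [2]_q ⋯ [k]_q`. -/
def qfact {F : Type*} [Field F] (q : F) : ℕ → F
  | 0 => 1
  | k + 1 => qfact q k * qint q (k + 1)

/-- The truncation `∑_{k<N} x^k/[k]_q!` of the q-exponential; for a nilpotent `x` with
`x^N = 0` this equals the (finite) sum `exp_q(x) = ∑_{k≥0} x^k/[k]_q!`. -/
def expqTrunc {F : Type*} [Field F] {A : Type*} [Ring A] [Algebra F A]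
    (q : F) (x : A) (N : ℕ) : A :=
  ∑ k ∈ Finset.range N, (qfact q k)⁻¹ • x ^ k

lemma qint_mul_aux {F : Type*} [Field F] (q : F) (k : ℕ) :
    qint q k * (q - q⁻¹) = q ^ k - q⁻¹ ^ k := by
  have h := (Commute.all q⁻¹ q).geom_sum₂_mul k
  have h2 : qint q k = ∑ i ∈ Finset.range k, q⁻¹ ^ i * q ^ (k - 1 - i) := by
    unfold qint
    exact Finset.sum_congr rfl fun i _ => mul_comm _ _
  rw [h2]
  linear_combination -h

lemma q_sub_ne {F : Type*} [Field F] (q : F) (hq0 : q ≠ 0)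
    (hq : ∀ k : ℕ, k ≠ 0 → q ^ k ≠ 1) : q - q⁻¹ ≠ 0 := by
  intro h
  apply hq 2 (by norm_num)
  have : q * (q - q⁻¹) = 0 := by rw [h, mul_zero]
  rw [mul_sub, mul_inv_cancel₀ hq0] at this
  linear_combination this

lemma qint_ne {F : Type*} [Field F] (q : F) (hq0 : q ≠ 0)
    (hq : ∀ k : ℕ, k ≠ 0 → q ^ k ≠ 1) (k : ℕ) (hk : k ≠ 0) : qint q k ≠ 0 := by
  intro h
  have h1 := qint_mul_aux q k
  rw [h, zero_mul] at h1
  apply hq (k + k) (by omega)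
  have h3 : q ^ k * q⁻¹ ^ k = 1 := by rw [← mul_pow, mul_inv_cancel₀ hq0, one_pow]
  rw [pow_add]
  linear_combination h3 - q ^ k * h1

lemma qfact_ne {F : Type*} [Field F] (q : F) (hq0 : q ≠ 0)
    (hq : ∀ k : ℕ, k ≠ 0 → q ^ k ≠ 1) (k : ℕ) : qfact q k ≠ 0 := by
  induction k with
  | zero => simp [qfact]
  | succ k ih => exact mul_ne_zero ih (qint_ne q hq0 hq _ (by omega))

lemma qint_add {F : Type*} [Field F] (q : F) (hq0 : q ≠ 0)
    (hq : ∀ k : ℕ, k ≠ 0 → q ^ k ≠ 1) (i j : ℕ) :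
    qint q (i + j) = q⁻¹ ^ j * qint q i + q ^ i * qint q j := by
  apply mul_right_cancel₀ (q_sub_ne q hq0 hq)
  rw [add_mul, mul_assoc, mul_assoc, qint_mul_aux, qint_mul_aux, qint_mul_aux, pow_add, pow_add]
  ring

lemma qcomm_pow {F : Type*} [Field F] {A : Type*} [Ring A] [Algebra F A]
    (c : F) (a b : A) (h : b * a = c • (a * b)) (i : ℕ) :
    b * a ^ i = c ^ i • (a ^ i * b) := by
  induction i with
  | zero => simp
  | succ i ih =>
    rw [pow_succ, ← mul_assoc, ih, smul_mul_assoc, mul_assoc, h, mul_smul_comm, smul_smul,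
      pow_succ, mul_assoc]

lemma qadd_pow_zero {F : Type*} [Field F] {A : Type*} [Ring A] [Algebra F A]
    (c : F) (a b : A) (h : b * a = c • (a * b)) (m n : ℕ) (ha : a ^ m = 0) (hb : b ^ n = 0) :
    (a + b) ^ (m + n) = 0 := by
  have key : ∀ k : ℕ, (a + b) ^ k ∈
      Submodule.span F {x : A | ∃ i j : ℕ, i + j = k ∧ x = a ^ i * b ^ j} := by
    intro k
    induction k with
    | zero => exact Submodule.subset_span ⟨0, 0, by simp⟩
    | succ k ih =>
      rw [pow_succ']
      generalize (a + b) ^ k = y at ih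
      induction ih using Submodule.span_induction with
      | mem x hx =>
        obtain ⟨i, j, hij, rfl⟩ := hx
        rw [add_mul, ← mul_assoc, ← mul_assoc, qcomm_pow c a b h, ← pow_succ', smul_mul_assoc,
          mul_assoc, ← pow_succ']
        exact add_mem (Submodule.subset_span ⟨i + 1, j, by omega, rfl⟩)
          (Submodule.smul_mem _ _ (Submodule.subset_span ⟨i, j + 1, by omega, rfl⟩))
      | zero => rw [mul_zero]; exact zero_mem _
      | add x y _ _ hx hy => rw [mul_add]; exact add_mem hx hy
      | smul r x _ hx => rw [mul_smul_comm]; exact Submodule.smul_mem _ _ hx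
  have hk := key (m + n)
  have hle : Submodule.span F {x : A | ∃ i j : ℕ, i + j = m + n ∧ x = a ^ i * b ^ j} ≤ ⊥ := by
    rw [Submodule.span_le]
    rintro x ⟨i, j, hij, rfl⟩
    rcases le_or_gt m i with h1 | h1
    · simp [pow_eq_zero_of_le h1 ha]
    · simp [pow_eq_zero_of_le (show n ≤ j by omega) hb]
  exact (Submodule.mem_bot F).1 (hle hk)

lemma expqTrunc_ext {F : Type*} [Field F] {A : Type*} [Ring A] [Algebra F A]
    (q : F) (x : A) (N N' : ℕ) (hN : N ≤ N') (h : x ^ N = 0) :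
    expqTrunc q x N = expqTrunc q x N' := by
  unfold expqTrunc
  apply Finset.sum_subset (Finset.range_subset_range.2 hN)
  intro k _ hk
  rw [pow_eq_zero_of_le (by simpa using hk) h, smul_zero]

lemma step_aux {F : Type*} [Field F] {A : Type*} [Ring A] [Algebra F A]
    (q : F) (X Z K : A) (hXK : X * K = K * X) (hKZ : K * Z = q⁻¹ • (Z * K))
    (hZX : Z * X = q • (X * Z))
    {M : Type*} [AddCommGroup M] [Module A M] [Module F M] [IsScalarTower F A M]
    (v : M) (hv : K • v = v) (i j : ℕ) :
    (X * K + Z) • (X ^ i * Z ^ j) • v =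
      q⁻¹ ^ j • (X ^ (i + 1) * Z ^ j) • v + q ^ i • (X ^ i * Z ^ (j + 1)) • v := by
  have h1 : X * K * (X ^ i * Z ^ j) = q⁻¹ ^ j • ((X ^ (i + 1) * Z ^ j) * K) := by
    have hc : K * X ^ i = X ^ i * K := ((show Commute X K from hXK).pow_left i).eq.symm
    rw [mul_assoc, ← mul_assoc K, hc, mul_assoc, qcomm_pow q⁻¹ Z K hKZ, mul_smul_comm,
      mul_smul_comm, pow_succ']
    simp only [mul_assoc]
  have h2 : Z * (X ^ i * Z ^ j) = q ^ i • (X ^ i * Z ^ (j + 1)) := by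
    rw [← mul_assoc, qcomm_pow q X Z hZX, smul_mul_assoc, mul_assoc, ← pow_succ']
  rw [smul_smul, add_mul, h1, h2, add_smul, smul_assoc, smul_assoc, mul_smul _ K v, hv]

lemma pow_aux {F : Type*} [Field F] {A : Type*} [Ring A] [Algebra F A]
    (q : F) (hq0 : q ≠ 0) (hq : ∀ k : ℕ, k ≠ 0 → q ^ k ≠ 1)
    (X Z K : A) (hXK : X * K = K * X) (hKZ : K * Z = q⁻¹ • (Z * K))
    (hZX : Z * X = q • (X * Z))
    {M : Type*} [AddCommGroup M] [Module A M] [Module F M] [IsScalarTower F A M]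
    (v : M) (hv : K • v = v) (n : ℕ) :
    (X * K + Z) ^ n • v = qfact q n • ∑ p ∈ Finset.HasAntidiagonal.antidiagonal n,
      ((qfact q p.1)⁻¹ * (qfact q p.2)⁻¹) • (X ^ p.1 * Z ^ p.2) • v := by
  have : SMulCommClass F A M := IsScalarTower.to_smulCommClass
  induction n with
  | zero => simp [qfact]
  | succ n ih =>
    rw [pow_succ', mul_smul, ih, smul_comm, Finset.smul_sum, qfact, mul_smul]
    congr 1
    have hR : qint q (n + 1) • ∑ p ∈ Finset.HasAntidiagonal.antidiagonal (n + 1),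
        ((qfact q p.1)⁻¹ * (qfact q p.2)⁻¹) • (X ^ p.1 * Z ^ p.2) • v =
        ∑ p ∈ Finset.HasAntidiagonal.antidiagonal (n + 1),
          (q⁻¹ ^ p.2 * qint q p.1 * ((qfact q p.1)⁻¹ * (qfact q p.2)⁻¹)) •
            (X ^ p.1 * Z ^ p.2) • v +
        ∑ p ∈ Finset.HasAntidiagonal.antidiagonal (n + 1),
          (q ^ p.1 * qint q p.2 * ((qfact q p.1)⁻¹ * (qfact q p.2)⁻¹)) •
            (X ^ p.1 * Z ^ p.2) • v := by
      rw [Finset.smul_sum, ← Finset.sum_add_distrib]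
      refine Finset.sum_congr rfl fun p hp => ?_
      rw [Finset.HasAntidiagonal.mem_antidiagonal] at hp
      rw [← hp, qint_add q hq0 hq, smul_smul, add_mul, add_smul]
    have h0 : qint q 0 = 0 := by simp [qint]
    rw [hR, Finset.Nat.sum_antidiagonal_succ, Finset.Nat.sum_antidiagonal_succ']
    simp only [h0, mul_zero, zero_mul, zero_smul, zero_add, add_zero]
    rw [← Finset.sum_add_distrib]
    refine Finset.sum_congr rfl fun p _ => ?_
    rw [smul_comm, step_aux q X Z K hXK hKZ hZX v hv, smul_add, smul_smul, smul_smul]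
    have e1 := qint_ne q hq0 hq (p.1 + 1) (by omega)
    have e2 := qint_ne q hq0 hq (p.2 + 1) (by omega)
    have e3 := qfact_ne q hq0 hq p.1
    have e4 := qfact_ne q hq0 hq p.2
    congr 2
    · simp only [qfact]; field_simp
    · simp only [qfact]; field_simp

/-- If `X K = K X`, `K Z = q⁻¹ Z K`, `Z X = q X Z` with `X, Z` nilpotent, then `X K + Z` is
nilpotent and `exp_q(X K + Z) v = exp_q(X) exp_q(Z) v` for any module vector `v` with `K v = v`
(q-exponentials expressed via truncations beyond the nilpotency degrees). -/
theorem expq_factorization {F : Type*} [Field F] {A : Type*} [Ring A] [Algebra F A]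
    (q : F) (hq0 : q ≠ 0) (hq : ∀ k : ℕ, k ≠ 0 → q ^ k ≠ 1)
    (X Z K : A) (hXK : X * K = K * X) (hKZ : K * Z = q⁻¹ • (Z * K)) (hZX : Z * X = q • (X * Z))
    (hXnil : IsNilpotent X) (hZnil : IsNilpotent Z) :
    IsNilpotent (X * K + Z) ∧
      ∀ (M : Type*) [AddCommGroup M] [Module A M] [Module F M] [IsScalarTower F A M]
        (v : M), K • v = v →
        ∀ N₁ N₂ N₃ : ℕ, (X * K + Z) ^ N₁ = 0 → X ^ N₂ = 0 → Z ^ N₃ = 0 →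
          expqTrunc q (X * K + Z) N₁ • v = (expqTrunc q X N₂ * expqTrunc q Z N₃) • v := by
  constructor
  · obtain ⟨m, hm⟩ := hXnil
    obtain ⟨n, hn⟩ := hZnil
    refine ⟨m + n, qadd_pow_zero (q * q) (X * K) Z ?_ m n ?_ hn⟩
    · have hZK : Z * K = q • (K * Z) := by rw [hKZ, smul_smul, mul_inv_cancel₀ hq0, one_smul]
      rw [← mul_assoc, hZX, smul_mul_assoc, mul_assoc, hZK, mul_smul_comm, smul_smul, mul_assoc]
    · rw [(show Commute X K from hXK).mul_pow, hm, zero_mul]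
  · intro M _ _ _ _ v hv N₁ N₂ N₃ h1 h2 h3
    have : SMulCommClass F A M := IsScalarTower.to_smulCommClass
    set N := N₁ + N₂ + N₃ with hN
    set f : ℕ → ℕ → M := fun i j =>
      ((qfact q i)⁻¹ * (qfact q j)⁻¹) • (X ^ i * Z ^ j) • v with hf
    have hL : expqTrunc q (X * K + Z) N₁ • v =
        ∑ n ∈ Finset.range N, ∑ i ∈ Finset.range (n + 1), f i (n - i) := by
      rw [expqTrunc_ext q _ N₁ N (by omega) h1, expqTrunc, Finset.sum_smul]
      refine Finset.sum_congr rfl fun n _ => ?_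
      rw [smul_assoc, pow_aux q hq0 hq X Z K hXK hKZ hZX v hv, smul_smul,
        inv_mul_cancel₀ (qfact_ne q hq0 hq n), one_smul,
        ← Finset.Nat.sum_antidiagonal_eq_sum_range_succ f]
    have hR : (expqTrunc q X N₂ * expqTrunc q Z N₃) • v =
        ∑ i ∈ Finset.range N, ∑ j ∈ Finset.range N, f i j := by
      rw [expqTrunc_ext q _ N₂ N (by omega) h2, expqTrunc_ext q _ N₃ N (by omega) h3,
        expqTrunc, expqTrunc, Finset.sum_mul_sum, Finset.sum_smul]
      refine Finset.sum_congr rfl fun i _ => ?_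
      rw [Finset.sum_smul]
      refine Finset.sum_congr rfl fun j _ => ?_
      rw [smul_mul_smul_comm, smul_assoc]
    rw [hL, hR, Finset.sum_range_diag_flip]
    refine Finset.sum_congr rfl fun i _ => ?_
    apply Finset.sum_subset (Finset.range_subset_range.2 (by omega))
    intro j _ hj
    simp only [Finset.mem_range, not_lt] at hj
    simp only [hf]
    rcases le_or_gt N₂ i with h | h
    · simp [pow_eq_zero_of_le h h2]
    · simp [pow_eq_zero_of_le (show N₃ ≤ j by omega) h3]
end

section
/- In $U_q(gl(m|n))$, for all $a < b$ in $\mathbf{I}$ one has $(q_a - q_a^{-1})\big( E_{a\,b} E_{b\,a} - (-1)^{[a]+[b]} E_{b\,a} E_{a\,b} \big) = K_a K_b^{-1} - K_a^{-1} K_b$, i.e. $[E_{a\,b}, E_{b\,a}\} = (K_a K_b^{-1} - K_a^{-1} K_b)/(q_a - q_a^{-1})$. -/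
open scoped BigOperators

/-- Parity `[a]` of the (1-based) index `a`: `0` for `a ≤ m`, `1` for `a > m`. -/
def par (m a : ℕ) : ℕ := if a ≤ m then 0 else 1

/-- `q_a = q^{(-1)^{[a]}}`: equals `q` for `a ≤ m` and `q⁻¹` for `a > m`. -/
def qpar {F : Type*} [Field F] (q : F) (m a : ℕ) : F := if a ≤ m then q else q⁻¹

/-- `Eup q m e a k = E_{a, a+k+1}`, built recursively from the simple raising generators
`e b = E_{b, b+1}` via `E_{a b} = E_{a c} E_{c b} - q_c⁻¹ E_{c b} E_{a c}` with `c = b - 1`. -/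
def Eup {F : Type*} [Field F] {A : Type*} [Ring A] [Algebra F A]
    (q : F) (m : ℕ) (e : ℕ → A) (a : ℕ) : ℕ → A
  | 0 => e a
  | k + 1 =>
      Eup q m e a k * e (a + k + 1) - (qpar q m (a + k + 1))⁻¹ • (e (a + k + 1) * Eup q m e a k)

/-- `Edown q m f a k = E_{a+k+1, a}`, built recursively from the simple lowering generators
`f b = E_{b+1, b}` via `E_{b a} = E_{b c} E_{c a} - q_c E_{c a} E_{b c}` with `c = b - 1`. -/
def Edown {F : Type*} [Field F] {A : Type*} [Ring A] [Algebra F A]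
    (q : F) (m : ℕ) (f : ℕ → A) (a : ℕ) : ℕ → A
  | 0 => f a
  | k + 1 =>
      f (a + k + 1) * Edown q m f a k - qpar q m (a + k + 1) • (Edown q m f a k * f (a + k + 1))

/-- The root vectors `E_{a b}` of `U_q(gl(m|n))` (and `0` for `a = b`, a value never used). -/
def EE {F : Type*} [Field F] {A : Type*} [Ring A] [Algebra F A]
    (q : F) (m : ℕ) (e f : ℕ → A) (a b : ℕ) : A :=
  if a < b then Eup q m e a (b - a - 1) else if b < a then Edown q m f b (a - b - 1) else 0

/-- A realization of the defining presentation of the quantum supergroup `U_q(gl(m|n))` in a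
unital associative `F`-algebra `A`: elements `K a`, `Kinv a` (`a ∈ I = {1,…,m+n}`) and
`e b = E_{b,b+1}`, `f b = E_{b+1,b}` (`b ∈ I' = {1,…,m+n-1}`) subject to the defining
relations of `U_q(gl(m|n))`. -/
structure UqGl (F : Type*) [Field F] (A : Type*) [Ring A] [Algebra F A]
    (m n : ℕ) (q : F) where
  K : ℕ → A
  Kinv : ℕ → A
  e : ℕ → A
  f : ℕ → A
  K_Kinv : ∀ a, 1 ≤ a → a ≤ m + n → K a * Kinv a = 1
  Kinv_K : ∀ a, 1 ≤ a → a ≤ m + n → Kinv a * K a = 1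
  K_comm : ∀ a b, 1 ≤ a → a ≤ m + n → 1 ≤ b → b ≤ m + n → K a * K b = K b * K a
  K_e : ∀ a b, 1 ≤ a → a ≤ m + n → 1 ≤ b → b + 1 ≤ m + n →
    K a * e b * Kinv a
      = (if a = b then qpar q m a else if a = b + 1 then (qpar q m a)⁻¹ else 1) • e b
  K_f : ∀ a b, 1 ≤ a → a ≤ m + n → 1 ≤ b → b + 1 ≤ m + n →
    K a * f b * Kinv a
      = (if a = b + 1 then qpar q m a else if a = b then (qpar q m a)⁻¹ else 1) • f b
  e_f : ∀ a b, 1 ≤ a → a + 1 ≤ m + n → 1 ≤ b → b + 1 ≤ m + n →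
    e a * f b - (if a = m ∧ b = m then (-1 : F) else 1) • (f b * e a)
      = if a = b
          then (qpar q m a - (qpar q m a)⁻¹)⁻¹ • (K a * Kinv (a + 1) - Kinv a * K (a + 1))
          else 0
  e_m_sq : e m ^ 2 = 0
  f_m_sq : f m ^ 2 = 0
  e_e : ∀ a b, 1 ≤ a → a + 1 ≤ m + n → 1 ≤ b → b + 1 ≤ m + n →
    (a + 2 ≤ b ∨ b + 2 ≤ a) → e a * e b = e b * e a
  f_f : ∀ a b, 1 ≤ a → a + 1 ≤ m + n → 1 ≤ b → b + 1 ≤ m + n →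
    (a + 2 ≤ b ∨ b + 2 ≤ a) → f a * f b = f b * f a
  serre_e : ∀ a b, 1 ≤ a → a + 1 ≤ m + n → 1 ≤ b → b + 1 ≤ m + n → a ≠ m →
    (b = a + 1 ∨ a = b + 1) →
    e a ^ 2 * e b - (q + q⁻¹) • (e a * e b * e a) + e b * e a ^ 2 = 0
  serre_f : ∀ a b, 1 ≤ a → a + 1 ≤ m + n → 1 ≤ b → b + 1 ≤ m + n → a ≠ m →
    (b = a + 1 ∨ a = b + 1) →
    f a ^ 2 * f b - (q + q⁻¹) • (f a * f b * f a) + f b * f a ^ 2 = 0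
  serre_extra_e : 2 ≤ m → 2 ≤ n →
    EE q m e f (m - 1) (m + 2) * e m + e m * EE q m e f (m - 1) (m + 2) = 0
  serre_extra_f : 2 ≤ m → 2 ≤ n →
    EE q m e f (m + 2) (m - 1) * f m + f m * EE q m e f (m + 2) (m - 1) = 0

section helpers
variable {F : Type*} [Field F] {A : Type*} [Ring A] [Algebra F A]

theorem core_aux (X x e f M M' L L' : A) (p r s t : F) (hp : p ≠ 0) (hpp : p - p⁻¹ ≠ 0)
    (hXf : X * f = f * X) (hex : e * x = x * e)
    (h1 : X * x = s • (x * X) + r • (M - M'))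
    (h2 : e * f = t • (f * e) + (p - p⁻¹)⁻¹ • (L - L'))
    (hLx : L * x = p • (x * L)) (hLx' : L' * x = p⁻¹ • (x * L'))
    (hLX : L * X = p⁻¹ • (X * L)) (hLX' : L' * X = p • (X * L'))
    (hMe : M * e = p⁻¹ • (e * M)) (hMe' : M' * e = p • (e * M'))
    (hMf : M * f = p • (f * M)) (hMf' : M' * f = p⁻¹ • (f * M'))
    (c1 : L * M = M * L) (c2 : L * M' = M' * L) (c3 : L' * M = M * L') (c4 : L' * M' = M' * L') :
    (X * e - p⁻¹ • (e * X)) * (f * x - p • (x * f))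
      - (s * t) • ((f * x - p • (x * f)) * (X * e - p⁻¹ • (e * X)))
      = r • (M * L - M' * L') := by
  have a0 : ∀ z, X * (f * z) = f * (X * z) := fun z => by rw [← mul_assoc, hXf, mul_assoc]
  have a1 : ∀ z, e * (x * z) = x * (e * z) := fun z => by rw [← mul_assoc, hex, mul_assoc]
  have a2 : ∀ z, X * (x * z) = s • (x * (X * z)) + r • (M * z - M' * z) := fun z => by
    rw [← mul_assoc, h1]; simp only [add_mul, sub_mul, smul_mul_assoc, mul_assoc]
  have a3 : ∀ z, e * (f * z) = t • (f * (e * z)) + (p - p⁻¹)⁻¹ • (L * z - L' * z) := fun z => by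
    rw [← mul_assoc, h2]; simp only [add_mul, sub_mul, smul_mul_assoc, mul_assoc]
  have a4 : ∀ z, L * (x * z) = p • (x * (L * z)) := fun z => by
    rw [← mul_assoc, hLx]; simp only [smul_mul_assoc, mul_assoc]
  have a5 : ∀ z, L' * (x * z) = p⁻¹ • (x * (L' * z)) := fun z => by
    rw [← mul_assoc, hLx']; simp only [smul_mul_assoc, mul_assoc]
  have a6 : ∀ z, M * (f * z) = p • (f * (M * z)) := fun z => by
    rw [← mul_assoc, hMf]; simp only [smul_mul_assoc, mul_assoc]
  have a7 : ∀ z, M' * (f * z) = p⁻¹ • (f * (M' * z)) := fun z => by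
    rw [← mul_assoc, hMf']; simp only [smul_mul_assoc, mul_assoc]
  simp only [mul_sub, sub_mul, mul_add, add_mul, smul_mul_assoc, mul_smul_comm, mul_assoc,
    hXf, hex, h1, h2, hLx, hLx', hLX, hLX', hMe, hMe', hMf, hMf', c1, c2, c3, c4,
    a0, a1, a2, a3, a4, a5, a6, a7]
  have h3 : p ^ 2 - 1 ≠ 0 := by
    intro h; apply hpp; field_simp; simpa using h
  match_scalars <;> field_simp <;> ring

theorem Kinv_swap {k k' y : A} {w : F} (hw : w ≠ 0) (h1 : k * k' = 1) (h2 : k' * k = 1)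
    (h : k * y = w • (y * k)) : k' * y = w⁻¹ • (y * k') := by
  have : y * k' = w • (k' * y) := by
    calc y * k' = k' * (k * y) * k' := by rw [← mul_assoc, h2, one_mul]
      _ = w • (k' * y) := by
        rw [h]; simp only [mul_smul_comm, smul_mul_assoc, mul_assoc, h1, mul_one]
  rw [this, smul_smul, inv_mul_cancel₀ hw, one_smul]

theorem K_swap_of {k k' y : A} {w : F} (h2 : k' * k = 1)
    (h : k * y * k' = w • y) : k * y = w • (y * k) := by
  rw [← smul_mul_assoc, ← h, mul_assoc, h2, mul_one]

theorem pair_swap {k l y : A} {v w u : F} (hk : k * y = v • (y * k)) (hl : l * y = w • (y * l))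
    (hu : v * w = u) : k * l * y = u • (y * (k * l)) := by
  rw [mul_assoc, hl, mul_smul_comm, ← mul_assoc, hk, smul_mul_assoc, smul_smul, mul_assoc,
    mul_comm w, hu]

theorem swap_mul {k y z : A} {v w u : F} (hk : k * y = v • (y * k)) (hl : k * z = w • (z * k))
    (hu : v * w = u) : k * (y * z) = u • (y * z * k) := by
  rw [← mul_assoc, hk, smul_mul_assoc, mul_assoc, hl, mul_smul_comm, smul_smul, hu, mul_assoc]

theorem swap_comb {k y z : A} {v w u c : F} (hk : k * y = v • (y * k)) (hl : k * z = w • (z * k))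
    (hu : v * w = u) : k * (y * z - c • (z * y)) = u • ((y * z - c • (z * y)) * k) := by
  rw [mul_sub, mul_smul_comm, swap_mul hk hl hu, swap_mul hl hk (by rw [mul_comm, hu]), sub_mul,
    smul_mul_assoc, smul_sub, smul_comm u c]

theorem comm_comb {k y z : A} {c : F} (hk : k * y = y * k) (hl : k * z = z * k) :
    k * (y * z - c • (z * y)) = (y * z - c • (z * y)) * k := by
  have := swap_comb (F := F) (v := 1) (w := 1) (u := 1) (c := c) (k := k) (y := y) (z := z)
    (by simpa using hk) (by simpa using hl) (by simp)
  simpa using this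

theorem qpar_ne {q : F} (hq0 : q ≠ 0) (m a : ℕ) : qpar q m a ≠ 0 := by
  unfold qpar; split_ifs
  · exact hq0
  · exact inv_ne_zero hq0

theorem qpar_sub_ne {q : F} (hq0 : q ≠ 0) (hq : ∀ k : ℕ, k ≠ 0 → q ^ k ≠ 1) (m a : ℕ) :
    qpar q m a - (qpar q m a)⁻¹ ≠ 0 := by
  have h : q ≠ q⁻¹ := by
    intro h
    apply hq 2 (by norm_num)
    rw [pow_two]; nth_rewrite 2 [h]; exact mul_inv_cancel₀ hq0
  unfold qpar; split_ifs
  · exact sub_ne_zero.2 h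
  · rw [inv_inv]; exact sub_ne_zero.2 h.symm

variable {m n : ℕ} {q : F} (U : UqGl F A m n q)

theorem Ke (a b : ℕ) (h1 : 1 ≤ a) (h2 : a ≤ m + n) (h3 : 1 ≤ b) (h4 : b + 1 ≤ m + n) :
    U.K a * U.e b = (if a = b then qpar q m a else if a = b + 1 then (qpar q m a)⁻¹ else 1) •
      (U.e b * U.K a) := K_swap_of (U.Kinv_K a h1 h2) (U.K_e a b h1 h2 h3 h4)

theorem Kf (a b : ℕ) (h1 : 1 ≤ a) (h2 : a ≤ m + n) (h3 : 1 ≤ b) (h4 : b + 1 ≤ m + n) :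
    U.K a * U.f b = (if a = b + 1 then qpar q m a else if a = b then (qpar q m a)⁻¹ else 1) •
      (U.f b * U.K a) := K_swap_of (U.Kinv_K a h1 h2) (U.K_f a b h1 h2 h3 h4)

theorem ef_ne (a b : ℕ) (h1 : 1 ≤ a) (h2 : a + 1 ≤ m + n) (h3 : 1 ≤ b) (h4 : b + 1 ≤ m + n)
    (hab : a ≠ b) : U.e a * U.f b = U.f b * U.e a := by
  have := U.e_f a b h1 h2 h3 h4
  rw [if_neg (by omega), if_neg hab, one_smul, sub_eq_zero] at this
  exact this

theorem K_Eup_far (a k j : ℕ) (ha : 1 ≤ a) (hj : a + k + 1 < j) (hjn : j ≤ m + n) :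
    U.K j * Eup q m U.e a k = (1 : F) • (Eup q m U.e a k * U.K j) := by
  induction k with
  | zero =>
    have := Ke U j a (by omega) hjn ha (by omega)
    rwa [if_neg (by omega), if_neg (by omega)] at this
  | succ k ih =>
    have := Ke U j (a + k + 1) (by omega) hjn (by omega) (by omega)
    rw [if_neg (by omega), if_neg (by omega)] at this
    exact swap_comb (ih (by omega)) this (by simp)

theorem K_Eup_near (a k : ℕ) (ha : 1 ≤ a) (hjn : a + k + 1 ≤ m + n) :
    U.K (a + k + 1) * Eup q m U.e a k
      = (qpar q m (a + k + 1))⁻¹ • (Eup q m U.e a k * U.K (a + k + 1)) := by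
  cases k with
  | zero =>
    have := Ke U (a + 1) a (by omega) hjn ha (by omega)
    rwa [if_neg (by omega), if_pos rfl] at this
  | succ k =>
    have := Ke U (a + (k + 1) + 1) (a + k + 1) (by omega) hjn (by omega) (by omega)
    rw [if_neg (by omega), if_pos (by omega)] at this
    exact swap_comb (K_Eup_far U a k _ ha (by omega) hjn) this (by simp)

theorem K_Edown_far (a k j : ℕ) (ha : 1 ≤ a) (hj : a + k + 1 < j) (hjn : j ≤ m + n) :
    U.K j * Edown q m U.f a k = (1 : F) • (Edown q m U.f a k * U.K j) := by
  induction k with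
  | zero =>
    have := Kf U j a (by omega) hjn ha (by omega)
    rwa [if_neg (by omega), if_neg (by omega)] at this
  | succ k ih =>
    have := Kf U j (a + k + 1) (by omega) hjn (by omega) (by omega)
    rw [if_neg (by omega), if_neg (by omega)] at this
    exact swap_comb this (ih (by omega)) (by simp)

theorem K_Edown_near (a k : ℕ) (ha : 1 ≤ a) (hjn : a + k + 1 ≤ m + n) :
    U.K (a + k + 1) * Edown q m U.f a k
      = (qpar q m (a + k + 1)) • (Edown q m U.f a k * U.K (a + k + 1)) := by
  cases k with
  | zero =>
    have := Kf U (a + 1) a (by omega) hjn ha (by omega)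
    rwa [if_pos rfl] at this
  | succ k =>
    have := Kf U (a + (k + 1) + 1) (a + k + 1) (by omega) hjn (by omega) (by omega)
    rw [if_pos (by omega)] at this
    exact swap_comb this (K_Edown_far U a k _ ha (by omega) hjn) (by simp)

theorem Eup_f (a k j : ℕ) (ha : 1 ≤ a) (hj : a + k < j) (hjn : j + 1 ≤ m + n) :
    U.f j * Eup q m U.e a k = Eup q m U.e a k * U.f j := by
  induction k with
  | zero => exact (ef_ne U a j ha (by omega) (by omega) hjn (by omega)).symm
  | succ k ih =>
    exact comm_comb (ih (by omega))
      (ef_ne U (a + k + 1) j (by omega) (by omega) (by omega) hjn (by omega)).symm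

theorem Edown_e (a k j : ℕ) (ha : 1 ≤ a) (hj : a + k < j) (hjn : j + 1 ≤ m + n) :
    U.e j * Edown q m U.f a k = Edown q m U.f a k * U.e j := by
  induction k with
  | zero => exact (ef_ne U j a (by omega) hjn ha (by omega) (by omega))
  | succ k ih =>
    exact comm_comb (ef_ne U j (a + k + 1) (by omega) (by omega) (by omega) (by omega) (by omega))
      (ih (by omega))

theorem sgn_step (m c : ℕ) :
    (if c = m ∧ c = m then (-1 : F) else 1) = (-1 : F) ^ (par m c + par m (c + 1)) := by
  unfold par
  by_cases h : c = m
  · subst h; simp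
  · by_cases h' : c ≤ m
    · have : c + 1 ≤ m := by omega
      simp [h, h', this]
    · have : ¬ (c + 1 ≤ m) := by omega
      simp [h, h', this]

theorem sgn_mul (m a c b : ℕ) :
    (-1 : F) ^ (par m a + par m c) * (-1 : F) ^ (par m c + par m b)
      = (-1 : F) ^ (par m a + par m b) := by
  unfold par
  split_ifs <;> norm_num

theorem main_aux (hq0 : q ≠ 0) (hq : ∀ k : ℕ, k ≠ 0 → q ^ k ≠ 1) (a k : ℕ) (ha : 1 ≤ a)
    (hk : a + k + 1 ≤ m + n) :
    Eup q m U.e a k * Edown q m U.f a k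
      = ((-1 : F) ^ (par m a + par m (a + k + 1))) • (Edown q m U.f a k * Eup q m U.e a k)
      + (qpar q m a - (qpar q m a)⁻¹)⁻¹ •
        (U.K a * U.Kinv (a + k + 1) - U.Kinv a * U.K (a + k + 1)) := by
  induction k with
  | zero =>
    have := U.e_f a a ha hk ha hk
    rw [if_pos rfl, sgn_step, sub_eq_iff_eq_add'] at this
    exact this
  | succ k ih =>
    have ih := ih (by omega)
    obtain ⟨c, hc⟩ : ∃ c, c = a + k + 1 := ⟨_, rfl⟩
    have hb : a + (k + 1) + 1 = c + 1 := by omega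
    have hp := qpar_ne hq0 m c
    have hpp := qpar_sub_ne hq0 hq m c
    have hec := U.e_f c c (by omega) (by omega) (by omega) (by omega)
    rw [if_pos rfl, sgn_step, sub_eq_iff_eq_add'] at hec
    have KX := K_Eup_near U a k ha (by omega)
    have Kx := K_Edown_near U a k ha (by omega)
    have BX := K_Eup_far U a k (c + 1) ha (by omega) (by omega)
    have Bx := K_Edown_far U a k (c + 1) ha (by omega) (by omega)
    have Ke1 := Ke U c c (by omega) (by omega) (by omega) (by omega)
    have Kf1 := Kf U c c (by omega) (by omega) (by omega) (by omega)
    have Ka1 := Ke U a c (by omega) (by omega) (by omega) (by omega)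
    have Ka2 := Kf U a c (by omega) (by omega) (by omega) (by omega)
    rw [if_pos rfl] at Ke1
    rw [if_neg (by omega), if_pos rfl] at Kf1
    rw [if_neg (by omega), if_neg (by omega)] at Ka1 Ka2
    have hXf := Eup_f U a k c ha (by omega) (by omega)
    have hxe := Edown_e U a k c ha (by omega) (by omega)
    have o1 : (1 : F) ≠ 0 := one_ne_zero
    have hpi := inv_ne_zero hp
    have a1 := U.K_Kinv a (by omega) (by omega)
    have a2 := U.Kinv_K a (by omega) (by omega)
    have c1 := U.K_Kinv c (by omega) (by omega)
    have c2 := U.Kinv_K c (by omega) (by omega)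
    have b1 := U.K_Kinv (c + 1) (by omega) (by omega)
    have b2 := U.Kinv_K (c + 1) (by omega) (by omega)
    have KK : ∀ i j, 1 ≤ i → i ≤ m + n → 1 ≤ j → j ≤ m + n → Commute (U.K i) (U.K j) :=
      fun i j h1 h2 h3 h4 => U.K_comm i j h1 h2 h3 h4
    have inv_of : ∀ i y, 1 ≤ i → i ≤ m + n → Commute (U.K i) y → Commute (U.Kinv i) y := by
      intro i y h1 h2 h
      have := Kinv_swap (F := F) (w := 1) one_ne_zero (U.K_Kinv i h1 h2) (U.Kinv_K i h1 h2)
        (by simpa using h.eq)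
      simpa [Commute, SemiconjBy] using this
    have IK : ∀ i j, 1 ≤ i → i ≤ m + n → 1 ≤ j → j ≤ m + n → Commute (U.Kinv i) (U.K j) :=
      fun i j h1 h2 h3 h4 => inv_of i _ h1 h2 (KK i j h1 h2 h3 h4)
    have KI : ∀ i j, 1 ≤ i → i ≤ m + n → 1 ≤ j → j ≤ m + n → Commute (U.K i) (U.Kinv j) :=
      fun i j h1 h2 h3 h4 => (IK j i h3 h4 h1 h2).symm
    have II : ∀ i j, 1 ≤ i → i ≤ m + n → 1 ≤ j → j ≤ m + n → Commute (U.Kinv i) (U.Kinv j) :=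
      fun i j h1 h2 h3 h4 => inv_of i _ h1 h2 (KI i j h1 h2 h3 h4)
    have ra : 1 ≤ a ∧ a ≤ m + n := by omega
    have rc : 1 ≤ c ∧ c ≤ m + n := by omega
    have rb : 1 ≤ c + 1 ∧ c + 1 ≤ m + n := by omega
    have hgoal := core_aux (Eup q m U.e a k) (Edown q m U.f a k) (U.e c) (U.f c)
      (U.K a * U.Kinv c) (U.Kinv a * U.K c) (U.K c * U.Kinv (c + 1)) (U.Kinv c * U.K (c + 1))
      (qpar q m c) (qpar q m a - (qpar q m a)⁻¹)⁻¹ _ _ hp hpp hXf.symm hxe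
      (by rw [← hc] at ih; exact ih) hec
      (pair_swap (by rw [← hc] at Kx; exact Kx) (Kinv_swap o1 b1 b2 Bx) (by simp))
      (pair_swap (Kinv_swap hp c1 c2 (by rw [← hc] at Kx; exact Kx)) Bx (by simp))
      (pair_swap (by rw [← hc] at KX; exact KX) (Kinv_swap o1 b1 b2 BX) (by simp))
      (pair_swap (Kinv_swap hpi c1 c2 (by rw [← hc] at KX; exact KX)) BX (by simp))
      (pair_swap Ka1 (Kinv_swap hp c1 c2 Ke1) (by simp))
      (pair_swap (Kinv_swap o1 a1 a2 Ka1) Ke1 (by simp))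
      (pair_swap Ka2 (Kinv_swap hpi c1 c2 Kf1) (by simp))
      (pair_swap (Kinv_swap o1 a1 a2 Ka2) Kf1 (by simp))
      (Commute.mul_left
        (Commute.mul_right (KK _ _ rc.1 rc.2 ra.1 ra.2) (KI _ _ rc.1 rc.2 rc.1 rc.2))
        (Commute.mul_right (IK _ _ rb.1 rb.2 ra.1 ra.2) (II _ _ rb.1 rb.2 rc.1 rc.2))).eq
      (Commute.mul_left
        (Commute.mul_right (KI _ _ rc.1 rc.2 ra.1 ra.2) (KK _ _ rc.1 rc.2 rc.1 rc.2))
        (Commute.mul_right (II _ _ rb.1 rb.2 ra.1 ra.2) (IK _ _ rb.1 rb.2 rc.1 rc.2))).eq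
      (Commute.mul_left
        (Commute.mul_right (IK _ _ rc.1 rc.2 ra.1 ra.2) (II _ _ rc.1 rc.2 rc.1 rc.2))
        (Commute.mul_right (KK _ _ rb.1 rb.2 ra.1 ra.2) (KI _ _ rb.1 rb.2 rc.1 rc.2))).eq
      (Commute.mul_left
        (Commute.mul_right (II _ _ rc.1 rc.2 ra.1 ra.2) (IK _ _ rc.1 rc.2 rc.1 rc.2))
        (Commute.mul_right (KI _ _ rb.1 rb.2 ra.1 ra.2) (KK _ _ rb.1 rb.2 rc.1 rc.2))).eq
    have e1 : U.K a * U.Kinv c * (U.K c * U.Kinv (c + 1)) = U.K a * U.Kinv (c + 1) := by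
      rw [mul_assoc, ← mul_assoc (U.Kinv c), c2, one_mul]
    have e2 : U.Kinv a * U.K c * (U.Kinv c * U.K (c + 1)) = U.Kinv a * U.K (c + 1) := by
      rw [mul_assoc, ← mul_assoc (U.K c), c1, one_mul]
    rw [e1, e2, sgn_mul, sub_eq_iff_eq_add'] at hgoal
    rw [hb]
    simp only [Eup, Edown]
    rw [← hc]
    exact hgoal

end helpers

/-- In `U_q(gl(m|n))`, for `a < b`:
`[E_{ab}, E_{ba}} = (K_a K_b⁻¹ - K_a⁻¹ K_b)/(q_a - q_a⁻¹)`, where the graded bracket carries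
the sign `(-1)^{[a]+[b]}`. -/
theorem EE_bracket_diagonal {F : Type*} [Field F] {A : Type*} [Ring A] [Algebra F A]
    (m n : ℕ) (hm : 1 ≤ m) (hn : 1 ≤ n) (q : F) (hq0 : q ≠ 0)
    (hq : ∀ k : ℕ, k ≠ 0 → q ^ k ≠ 1) (U : UqGl F A m n q)
    (a b : ℕ) (ha : 1 ≤ a) (hab : a < b) (hb : b ≤ m + n) :
    (qpar q m a - (qpar q m a)⁻¹) •
        (EE q m U.e U.f a b * EE q m U.e U.f b a
          - ((-1 : F) ^ (par m a + par m b)) • (EE q m U.e U.f b a * EE q m U.e U.f a b))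
      = U.K a * U.Kinv b - U.Kinv a * U.K b := by
  obtain ⟨k, rfl⟩ : ∃ k, b = a + k + 1 := ⟨b - a - 1, by omega⟩
  have h1 : EE q m U.e U.f a (a + k + 1) = Eup q m U.e a k := by
    unfold EE; rw [if_pos hab]; congr 1; omega
  have h2 : EE q m U.e U.f (a + k + 1) a = Edown q m U.f a k := by
    unfold EE; rw [if_neg (by omega), if_pos hab]; congr 1; omega
  rw [h1, h2, main_aux U hq0 hq a k ha hb, add_sub_cancel_left, smul_smul,
    mul_inv_cancel₀ (qpar_sub_ne hq0 hq m a), one_smul]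
end

section
/- With the difference operators on $P = F[w_1, \dots, w_N]$ as in the context, the q-Serre relations hold as identities of $F$-linear operators on $P$: for $a, b \in \{1,\dots,N-1\}$ with $|a - b| = 1$, $\mathcal{E}_a^2 \mathcal{E}_b - (q + q^{-1})\, \mathcal{E}_a \mathcal{E}_b \mathcal{E}_a + \mathcal{E}_b \mathcal{E}_a^2 = 0$ and $\mathcal{F}_a^2 \mathcal{F}_b - (q + q^{-1})\, \mathcal{F}_a \mathcal{F}_b \mathcal{F}_a + \mathcal{F}_b \mathcal{F}_a^2 = 0$; moreover $\mathcal{E}_a \mathcal{E}_b = \mathcal{E}_b \mathcal{E}_a$ and $\mathcal{F}_a \mathcal{F}_b = \mathcal{F}_b \mathcal{F}_a$ for $|a - b| \geq 2$. -/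
open MvPolynomial
open scoped BigOperators

/-- The scaling algebra automorphism `σ_a(t)` of `F[w_1, …, w_N]` with `w_a ↦ t w_a` and
`w_b ↦ w_b` for `b ≠ a`. -/
noncomputable def sigmaOp (F : Type*) [Field F] (N : ℕ) (t : F) (a : Fin N) :
    MvPolynomial (Fin N) F →ₐ[F] MvPolynomial (Fin N) F :=
  aeval fun b => if b = a then C t * X b else X b

/-- The operator `𝒦_a = γ σ_a⁻¹` (so `𝒦_a` rescales `w_a ↦ q⁻¹ w_a` and multiplies by `γ`). -/
noncomputable def Kop (F : Type*) [Field F] (N : ℕ) (γ q : F) (a : Fin N)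
    (p : MvPolynomial (Fin N) F) : MvPolynomial (Fin N) F :=
  γ • sigmaOp F N q⁻¹ a p

/-- The operator `𝒦_a⁻¹ = γ⁻¹ σ_a`. -/
noncomputable def Kinvop (F : Type*) [Field F] (N : ℕ) (γ q : F) (a : Fin N)
    (p : MvPolynomial (Fin N) F) : MvPolynomial (Fin N) F :=
  γ⁻¹ • sigmaOp F N q a p

/-- The operator `ℰ_a = -w_{a+1} ∇_a` (for `1 ≤ a ≤ N-1`; here `i.castSucc` plays the role of
`a` and `i.succ` of `a+1`), given the q-difference operators `∇`. -/
noncomputable def Eop (F : Type*) [Field F] (n : ℕ)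
    (nab : Fin (n + 1) → MvPolynomial (Fin (n + 1)) F →ₗ[F] MvPolynomial (Fin (n + 1)) F)
    (i : Fin n) (p : MvPolynomial (Fin (n + 1)) F) : MvPolynomial (Fin (n + 1)) F :=
  -(X i.succ * nab i.castSucc p)

/-- The operator `ℱ_a = -w_a ∇_{a+1}`. -/
noncomputable def Fop (F : Type*) [Field F] (n : ℕ)
    (nab : Fin (n + 1) → MvPolynomial (Fin (n + 1)) F →ₗ[F] MvPolynomial (Fin (n + 1)) F)
    (i : Fin n) (p : MvPolynomial (Fin (n + 1)) F) : MvPolynomial (Fin (n + 1)) F :=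
  -(X i.castSucc * nab i.succ p)

/-- `nab` is the family of q-difference operators `∇_a` on `F[w_1, …, w_{n+1}]`, acting on
monomials by `w_a^k ∏ w_b^{k_b} ↦ [k]_q w_a^{k-1} ∏ w_b^{k_b}`. -/
def IsNabla (F : Type*) [Field F] (n : ℕ) (q : F)
    (nab : Fin (n + 1) → MvPolynomial (Fin (n + 1)) F →ₗ[F] MvPolynomial (Fin (n + 1)) F) :
    Prop :=
  ∀ (a : Fin (n + 1)) (d : Fin (n + 1) →₀ ℕ),
    nab a (monomial d 1) = qint q (d a) • monomial (d - Finsupp.single a 1) 1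

theorem qint_mul {F : Type*} [Field F] (q : F) (k : ℕ) :
    qint q k * (q⁻¹ - q) = q⁻¹ ^ k - q ^ k := by
  rw [← geom_sum₂_mul, qint]
  congr 1
  exact Finset.sum_congr rfl fun i _ => mul_comm _ _

theorem qint_rec {F : Type*} [Field F] (q : F) (hq0 : q ≠ 0) (h2 : q ^ 2 ≠ 1) (k : ℕ) :
    qint q (k + 2) - (q + q⁻¹) * qint q (k + 1) + qint q k = 0 := by
  have hne : q⁻¹ - q ≠ 0 := by
    intro h
    apply h2
    have h3 : q⁻¹ = q := sub_eq_zero.mp h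
    have h4 : q⁻¹ * q = 1 := inv_mul_cancel₀ hq0
    rw [h3] at h4
    rw [pow_two, h4]
  apply mul_right_cancel₀ hne
  have e : q * q⁻¹ = 1 := mul_inv_cancel₀ hq0
  have h0 := qint_mul q k
  have h1 := qint_mul q (k + 1)
  have h3 := qint_mul q (k + 2)
  rw [zero_mul, add_mul, sub_mul, mul_assoc, h0, h1, h3]
  generalize q⁻¹ = r at *
  ring_nf
  linear_combination (q ^ k - r ^ k) * e

section
variable {F : Type*} [Field F] {n : ℕ} {q : F}
  {nab : Fin (n + 1) → MvPolynomial (Fin (n + 1)) F →ₗ[F] MvPolynomial (Fin (n + 1)) F}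

theorem ext_mon {L M : MvPolynomial (Fin (n + 1)) F →ₗ[F] MvPolynomial (Fin (n + 1)) F}
    (h : ∀ d, L (monomial d 1) = M (monomial d 1)) (p) : L p = M p := by
  have : L = M := by
    apply (MvPolynomial.basisMonomials (Fin (n + 1)) F).ext
    intro d
    simpa using h d
  rw [this]

theorem X_mon (y : Fin (n + 1)) (d : Fin (n + 1) →₀ ℕ) :
    (X y : MvPolynomial (Fin (n + 1)) F) * monomial d 1 = monomial (d + Finsupp.single y 1) 1 := by
  rw [X, monomial_mul, one_mul, add_comm d]

theorem nab_X_ne (h : IsNabla F n q nab) {x y : Fin (n + 1)} (hxy : x ≠ y) (p) :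
    nab x (X y * p) = X y * nab x p := by
  refine ext_mon (L := nab x ∘ₗ LinearMap.mulLeft F (X y))
    (M := LinearMap.mulLeft F (X y) ∘ₗ nab x) (fun d => ?_) p
  simp only [LinearMap.comp_apply, LinearMap.mulLeft_apply]
  rw [X_mon, h, h, mul_smul_comm, X_mon]
  have e1 : (d + Finsupp.single y 1 : Fin (n + 1) →₀ ℕ) x = d x := by simp [hxy.symm, Finsupp.single_apply]
  have e2 : d + Finsupp.single y 1 - Finsupp.single x 1
      = d - Finsupp.single x 1 + Finsupp.single y 1 := by
    ext i
    simp only [Finsupp.add_apply, Finsupp.tsub_apply, Finsupp.single_apply]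
    split_ifs with h1 h2
    · exact absurd (h2.trans h1.symm) hxy
    all_goals omega
  rw [e1, e2]

theorem nab_comm (h : IsNabla F n q nab) (x y : Fin (n + 1)) (p) :
    nab x (nab y p) = nab y (nab x p) := by
  by_cases hxy : x = y
  · rw [hxy]
  refine ext_mon (L := nab x ∘ₗ nab y) (M := nab y ∘ₗ nab x) (fun d => ?_) p
  simp only [LinearMap.comp_apply]
  rw [h, h, map_smul, map_smul, h, h, smul_smul, smul_smul]
  have e1 : (d - Finsupp.single y 1 : Fin (n + 1) →₀ ℕ) x = d x := by simp [Ne.symm hxy, Finsupp.single_apply]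
  have e2 : (d - Finsupp.single x 1 : Fin (n + 1) →₀ ℕ) y = d y := by simp [hxy, Finsupp.single_apply]
  rw [e1, e2, tsub_right_comm, mul_comm]

theorem qint_zero' : qint q 0 = 0 := by simp [qint]

theorem X_nab (h : IsNabla F n q nab) (x : Fin (n + 1)) (d) :
    X x * nab x (monomial d 1) = qint q (d x) • monomial d 1 := by
  rw [h, mul_smul_comm, X_mon]
  rcases Nat.eq_zero_or_pos (d x) with h0 | h0
  · rw [h0, qint_zero', zero_smul, zero_smul]
  · rw [tsub_add_cancel_of_le]
    exact Finsupp.single_le_iff.mpr h0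

theorem nab_X (h : IsNabla F n q nab) (x : Fin (n + 1)) (d) :
    nab x (X x * monomial d 1) = qint q (d x + 1) • monomial d 1 := by
  rw [X_mon, h]
  simp

theorem serreD (hq0 : q ≠ 0) (h2 : q ^ 2 ≠ 1) (h : IsNabla F n q nab) (x : Fin (n + 1)) (p) :
    nab x (nab x (X x * p)) - (q + q⁻¹) • nab x (X x * nab x p) + X x * nab x (nab x p) = 0 := by
  refine ext_mon (L := nab x ∘ₗ nab x ∘ₗ LinearMap.mulLeft F (X x)
    - (q + q⁻¹) • (nab x ∘ₗ LinearMap.mulLeft F (X x) ∘ₗ nab x)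
    + LinearMap.mulLeft F (X x) ∘ₗ nab x ∘ₗ nab x) (M := 0) (fun d => ?_) p
  simp only [LinearMap.comp_apply, LinearMap.mulLeft_apply, LinearMap.add_apply,
    LinearMap.sub_apply, LinearMap.smul_apply, LinearMap.zero_apply]
  rw [nab_X h, X_nab h, map_smul, map_smul, h]
  rcases hk : d x with _ | k
  · simp [qint_zero']
  · rw [map_smul, mul_smul_comm, X_nab h]
    have e : (d - Finsupp.single x 1 : Fin (n + 1) →₀ ℕ) x = k := by simp [hk]
    rw [e]
    simp only [smul_smul, ← sub_smul, ← add_smul]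
    rw [show ∀ t : F, t = 0 → t • monomial (d - Finsupp.single x 1) (1 : F) = 0 from
      fun t ht => by rw [ht, zero_smul]]
    linear_combination qint q (k + 1) * qint_rec q hq0 h2 k

theorem serreX (hq0 : q ≠ 0) (h2 : q ^ 2 ≠ 1) (h : IsNabla F n q nab) (x : Fin (n + 1)) (p) :
    X x * (X x * nab x p) - (q + q⁻¹) • (X x * nab x (X x * p)) + nab x (X x * (X x * p)) = 0 := by
  refine ext_mon (L := LinearMap.mulLeft F (X x) ∘ₗ LinearMap.mulLeft F (X x) ∘ₗ nab x
    - (q + q⁻¹) • (LinearMap.mulLeft F (X x) ∘ₗ nab x ∘ₗ LinearMap.mulLeft F (X x))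
    + nab x ∘ₗ LinearMap.mulLeft F (X x) ∘ₗ LinearMap.mulLeft F (X x)) (M := 0) (fun d => ?_) p
  simp only [LinearMap.comp_apply, LinearMap.mulLeft_apply, LinearMap.add_apply,
    LinearMap.sub_apply, LinearMap.smul_apply, LinearMap.zero_apply]
  rw [nab_X h, X_nab h, mul_smul_comm, mul_smul_comm, X_mon, nab_X h]
  simp only [smul_smul, ← sub_smul, ← add_smul]
  rw [show ∀ t : F, t = 0 → t • monomial (d + Finsupp.single x 1) (1 : F) = 0 from
      fun t ht => by rw [ht, zero_smul]]
  have e : (d + Finsupp.single x 1 : Fin (n + 1) →₀ ℕ) x = d x + 1 := by simp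
  rw [e]
  linear_combination qint_rec q hq0 h2 (d x)

/-- the operator `-w_y ∇_x` -/
noncomputable def wdOp (nab : Fin (n + 1) → MvPolynomial (Fin (n + 1)) F →ₗ[F] MvPolynomial (Fin (n + 1)) F)
    (x y : Fin (n + 1)) (p : MvPolynomial (Fin (n + 1)) F) : MvPolynomial (Fin (n + 1)) F :=
  -(X y * nab x p)

theorem serre1 (hq0 : q ≠ 0) (h2 : q ^ 2 ≠ 1) (h : IsNabla F n q nab) {x y z : Fin (n + 1)}
    (hxy : x ≠ y) (hyz : y ≠ z) (hxz : x ≠ z) (p) :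
    wdOp nab x y (wdOp nab x y (wdOp nab y z p))
      - (q + q⁻¹) • wdOp nab x y (wdOp nab y z (wdOp nab x y p))
      + wdOp nab y z (wdOp nab x y (wdOp nab x y p)) = 0 := by
  have key := serreX hq0 h2 h y (nab x (nab x p))
  simp only [wdOp, map_neg, mul_neg, neg_neg, nab_X_ne h hxy, nab_X_ne h hxz, nab_X_ne h hyz,
    nab_comm h x y]
  simp only [MvPolynomial.smul_eq_C_mul] at key ⊢
  linear_combination (-X z) * key

theorem serre2 (hq0 : q ≠ 0) (h2 : q ^ 2 ≠ 1) (h : IsNabla F n q nab) {x y z : Fin (n + 1)}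
    (hxy : x ≠ y) (hyz : y ≠ z) (hxz : x ≠ z) (p) :
    wdOp nab y z (wdOp nab y z (wdOp nab x y p))
      - (q + q⁻¹) • wdOp nab y z (wdOp nab x y (wdOp nab y z p))
      + wdOp nab x y (wdOp nab y z (wdOp nab y z p)) = 0 := by
  have key := serreD hq0 h2 h y (nab x p)
  simp only [wdOp, map_neg, mul_neg, neg_neg, nab_X_ne h hxy, nab_X_ne h hxz, nab_X_ne h hyz,
    nab_comm h x y, mul_left_comm (X y) (X z)]
  simp only [MvPolynomial.smul_eq_C_mul] at key ⊢
  linear_combination (-X z * X z) * key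

theorem top_comm (h : IsNabla F n q nab) {x y z w : Fin (n + 1)}
    (hxw : x ≠ w) (hzy : z ≠ y) (p) :
    wdOp nab x y (wdOp nab z w p) = wdOp nab z w (wdOp nab x y p) := by
  simp only [wdOp, map_neg, mul_neg, neg_neg, nab_X_ne h hxw, nab_X_ne h hzy, nab_comm h x z]
  ring
end

/-- The difference operators `ℰ_a = -w_{a+1} ∇_a`, `ℱ_a = -w_a ∇_{a+1}` on
`F[w_1, …, w_{n+1}]` satisfy the q-Serre relations
`ℰ_a² ℰ_b - (q + q⁻¹) ℰ_a ℰ_b ℰ_a + ℰ_b ℰ_a² = 0` (and the `ℱ` version) for `|a - b| = 1`,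
and commute, `ℰ_a ℰ_b = ℰ_b ℰ_a`, `ℱ_a ℱ_b = ℱ_b ℱ_a`, for `|a - b| ≥ 2`. -/
theorem difference_operators_q_serre (F : Type*) [Field F] (q : F) (hq0 : q ≠ 0)
    (hq : ∀ k : ℕ, k ≠ 0 → q ^ k ≠ 1) (n : ℕ) (hn : 1 ≤ n) (γ : F) (hγ : γ ≠ 0)
    (nab : Fin (n + 1) → MvPolynomial (Fin (n + 1)) F →ₗ[F] MvPolynomial (Fin (n + 1)) F)
    (hnab : IsNabla F n q nab) :
    (∀ a b : Fin n, ((a : ℕ) + 1 = b ∨ (b : ℕ) + 1 = a) →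
      ∀ p : MvPolynomial (Fin (n + 1)) F,
        Eop F n nab a (Eop F n nab a (Eop F n nab b p))
            - (q + q⁻¹) • Eop F n nab a (Eop F n nab b (Eop F n nab a p))
            + Eop F n nab b (Eop F n nab a (Eop F n nab a p)) = 0) ∧
    (∀ a b : Fin n, ((a : ℕ) + 1 = b ∨ (b : ℕ) + 1 = a) →
      ∀ p : MvPolynomial (Fin (n + 1)) F,
        Fop F n nab a (Fop F n nab a (Fop F n nab b p))
            - (q + q⁻¹) • Fop F n nab a (Fop F n nab b (Fop F n nab a p))
            + Fop F n nab b (Fop F n nab a (Fop F n nab a p)) = 0) ∧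
    (∀ a b : Fin n, ((a : ℕ) + 2 ≤ b ∨ (b : ℕ) + 2 ≤ a) →
      ∀ p : MvPolynomial (Fin (n + 1)) F,
        Eop F n nab a (Eop F n nab b p) = Eop F n nab b (Eop F n nab a p)) ∧
    (∀ a b : Fin n, ((a : ℕ) + 2 ≤ b ∨ (b : ℕ) + 2 ≤ a) →
      ∀ p : MvPolynomial (Fin (n + 1)) F,
        Fop F n nab a (Fop F n nab b p) = Fop F n nab b (Fop F n nab a p)) := by
  have h2 := hq 2 (by norm_num)
  have hE : Eop F n nab = fun i => wdOp nab i.castSucc i.succ := rfl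
  have hF : Fop F n nab = fun i => wdOp nab i.succ i.castSucc := rfl
  rw [hE, hF]
  refine ⟨?_, ?_, ?_, ?_⟩
  · rintro a b (hab | hab) p
    · have e : b.castSucc = a.succ := Fin.ext (by simp [← hab])
      simp only [e]
      apply serre1 hq0 h2 hnab <;> simp only [ne_eq, Fin.ext_iff, Fin.val_castSucc, Fin.val_succ] <;> omega
    · have e : b.succ = a.castSucc := Fin.ext (by simp [← hab])
      simp only [e]
      apply serre2 hq0 h2 hnab <;> simp only [ne_eq, Fin.ext_iff, Fin.val_castSucc, Fin.val_succ] <;> omega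
  · rintro a b (hab | hab) p
    · have e : b.castSucc = a.succ := Fin.ext (by simp [← hab])
      simp only [e]
      apply serre2 hq0 h2 hnab <;> simp only [ne_eq, Fin.ext_iff, Fin.val_castSucc, Fin.val_succ] <;> omega
    · have e : b.succ = a.castSucc := Fin.ext (by simp [← hab])
      simp only [e]
      apply serre1 hq0 h2 hnab <;> simp only [ne_eq, Fin.ext_iff, Fin.val_castSucc, Fin.val_succ] <;> omega
  · intro a b hab p
    apply top_comm hnab <;> simp only [ne_eq, Fin.ext_iff, Fin.val_castSucc, Fin.val_succ] <;> omega
  · intro a b hab p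
    apply top_comm hnab <;> simp only [ne_eq, Fin.ext_iff, Fin.val_castSucc, Fin.val_succ] <;> omega
end
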